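/- Let 1 < p < ∞ and let Q₀ ⊂ ℝⁿ be a cube with sides parallel to the coordinate axes. There exists a constant A = A(p,Q₀,n) such that for every f ∈ L¹(Q₀) with JN_p(f,Q₀) < ∞, one has f − f_{Q₀} ∈ L(p,∞)(Q₀) with sup_{t>0} t · (λ_{f−f_{Q₀}}(t))^{1/p} ≤ A · JN_p(f,Q₀), where λ is the distribution function with respect to Lebesgue measure restricted to Q₀. -/

import Mathlib

open MeasureTheory Set
open scoped ENNReal NNReal

noncomputable section

/-- The distribution function `λ_f(t) = μ {x : |f(x)| > t}`. -/
def distFun {α : Type*} [MeasurableSpace α] (μ : Measure α) (f : α → ℝ) (t : ℝ) : ℝ≥0∞ :=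
  μ {x | t < |f x|}

/-- The non-increasing rearrangement `f*(t) = inf {s > 0 : λ_f(s) ≤ t}`. -/
def rearr {α : Type*} [MeasurableSpace α] (μ : Measure α) (f : α → ℝ) (t : ℝ) : ℝ≥0∞ :=
  sInf (ENNReal.ofReal '' {s : ℝ | 0 < s ∧ distFun μ f s ≤ ENNReal.ofReal t})

/-- The maximal function `f**(t) = (1/t) ∫₀ᵗ f*(s) ds`. -/
def dstar {α : Type*} [MeasurableSpace α] (μ : Measure α) (f : α → ℝ) (t : ℝ) : ℝ≥0∞ :=
  (∫⁻ s in Set.Ioc (0 : ℝ) t, rearr μ f s) / ENNReal.ofReal t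

/-- The `L(∞,∞)` "norm" : `sup_{t>0} (f**(t) - f*(t))`. -/
def oscNorm {α : Type*} [MeasurableSpace α] (μ : Measure α) (f : α → ℝ) : ℝ≥0∞ :=
  ⨆ (t : ℝ) (_ : 0 < t), dstar μ f t - rearr μ f t

/-- The Marcinkiewicz `L(p,∞)` quasinorm `‖f‖*_{L(p,∞)} = sup_{t>0} t (λ_f(t))^{1/p}`. -/
def wkNorm {α : Type*} [MeasurableSpace α] (μ : Measure α) (p : ℝ) (f : α → ℝ) : ℝ≥0∞ :=
  ⨆ (t : ℝ) (_ : 0 < t), ENNReal.ofReal t * distFun μ f t ^ (1 / p)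

/-- `‖f‖_{L(p,∞)} = sup_{s>0} s^{1/p} f**(s)`. -/
def wkNormStarStar {α : Type*} [MeasurableSpace α] (μ : Measure α) (p : ℝ) (f : α → ℝ) : ℝ≥0∞ :=
  ⨆ (s : ℝ) (_ : 0 < s), ENNReal.ofReal s ^ (1 / p) * dstar μ f s

/-- `‖f‖*_{L(p,∞)} = sup_{s>0} s^{1/p} f*(s)` (rearrangement form). -/
def wkNormStar {α : Type*} [MeasurableSpace α] (μ : Measure α) (p : ℝ) (f : α → ℝ) : ℝ≥0∞ :=
  ⨆ (s : ℝ) (_ : 0 < s), ENNReal.ofReal s ^ (1 / p) * rearr μ f s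

/-- `‖f‖^#_{L(p,∞)} = sup_{s>0} s^{1/p} (f**(s) - f*(s))`. -/
def sharpNorm {α : Type*} [MeasurableSpace α] (μ : Measure α) (p : ℝ) (f : α → ℝ) : ℝ≥0∞ :=
  ⨆ (s : ℝ) (_ : 0 < s), ENNReal.ofReal s ^ (1 / p) * (dstar μ f s - rearr μ f s)

/-- `‖f‖^{##}_{L(p,∞)} = sup_{t>0} (λ_f(t))^{-(1-1/p)} ∫_t^∞ λ_f(s) ds`. -/
def sharpSharpNorm {α : Type*} [MeasurableSpace α] (μ : Measure α) (p : ℝ) (f : α → ℝ) : ℝ≥0∞ :=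
  ⨆ (t : ℝ) (_ : 0 < t),
    distFun μ f t ^ (-(1 - 1 / p)) * ∫⁻ s in Set.Ioi t, distFun μ f s

/-- `‖f‖^{##}_{L(∞,∞)} = inf {C : ∫_t^∞ λ_f(s) ds ≤ C λ_f(t) for all t > 0}`. -/
def sharpSharpInf {α : Type*} [MeasurableSpace α] (μ : Measure α) (f : α → ℝ) : ℝ≥0∞ :=
  sInf {C : ℝ≥0∞ | ∀ t : ℝ, 0 < t →
    ∫⁻ s in Set.Ioi t, distFun μ f s ≤ C * distFun μ f t}

/-- O'Neil's quantity `inf {C^{1/p} : ∫_t^∞ λ_f(s) ds ≤ C t^{1-p} for all t > 0}`. -/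
def oneilQuantity {α : Type*} [MeasurableSpace α] (μ : Measure α) (p : ℝ) (f : α → ℝ) : ℝ≥0∞ :=
  sInf {D : ℝ≥0∞ | ∃ C : ℝ≥0∞, D = C ^ (1 / p) ∧
    ∀ t : ℝ, 0 < t → ∫⁻ s in Set.Ioi t, distFun μ f s ≤ C * ENNReal.ofReal t ^ (1 - p)}

/-- A cube in `ℝⁿ` with sides parallel to the coordinate axes. -/
def IsCube {n : ℕ} (Q : Set (Fin n → ℝ)) : Prop :=
  ∃ (a : Fin n → ℝ) (l : ℝ), 0 < l ∧ Q = Set.univ.pi fun i => Set.Icc (a i) (a i + l)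

/-- A countable family of subcubes of `Q₀` with pairwise disjoint interiors. -/
def IsPackingIn {n : ℕ} (Q₀ : Set (Fin n → ℝ)) (Q : ℕ → Set (Fin n → ℝ)) : Prop :=
  (∀ i, IsCube (Q i) ∧ Q i ⊆ Q₀) ∧
    Pairwise fun i j => interior (Q i) ∩ interior (Q j) = ∅

/-- The average `f_Q = (1/|Q|) ∫_Q f`. -/
def cubeAvg {n : ℕ} (f : (Fin n → ℝ) → ℝ) (Q : Set (Fin n → ℝ)) : ℝ :=
  ⨍ x in Q, f x

/-- The mean oscillation `(1/|Q|) ∫_Q |f - f_Q|`. -/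
def meanOsc {n : ℕ} (f : (Fin n → ℝ) → ℝ) (Q : Set (Fin n → ℝ)) : ℝ :=
  ⨍ x in Q, |f x - cubeAvg f Q|

/-- The John–Nirenberg functional `JN_p(f,Q₀)`. -/
def JN {n : ℕ} (p : ℝ) (f : (Fin n → ℝ) → ℝ) (Q₀ : Set (Fin n → ℝ)) : ℝ≥0∞ :=
  ⨆ (Q : ℕ → Set (Fin n → ℝ)) (_ : IsPackingIn Q₀ Q),
    (∑' i, volume (Q i) * ENNReal.ofReal (meanOsc f (Q i)) ^ p) ^ (1 / p)

/-- The BMO norm `‖f‖_{BMO(Q₀)}`. -/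
def bmoNorm {n : ℕ} (f : (Fin n → ℝ) → ℝ) (Q₀ : Set (Fin n → ℝ)) : ℝ≥0∞ :=
  ⨆ (Q : Set (Fin n → ℝ)) (_ : IsCube Q ∧ Q ⊆ Q₀), ENNReal.ofReal (meanOsc f Q)

/-- The Garsia–Rodemich functional `GaRo_p(f,Q₀)`: the least constant `C` such that
for every packing `{Qᵢ}` of `Q₀`,
`Σᵢ (1/|Qᵢ|) ∫_{Qᵢ}∫_{Qᵢ} |f(x)-f(y)| dx dy ≤ C (Σᵢ |Qᵢ|)^{1/p'}` where `1/p' = 1 - 1/p`. -/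
def GaRo {n : ℕ} (p : ℝ) (f : (Fin n → ℝ) → ℝ) (Q₀ : Set (Fin n → ℝ)) : ℝ≥0∞ :=
  sInf {C : ℝ≥0∞ | ∀ Q : ℕ → Set (Fin n → ℝ), IsPackingIn Q₀ Q →
    (∑' i, (volume (Q i))⁻¹ *
        ∫⁻ x in Q i, ∫⁻ y in Q i, ENNReal.ofReal |f x - f y|) ≤
      C * (∑' i, volume (Q i)) ^ (1 - 1 / p)}

/-- Points in a common cell of nested partitions share all coarser cells. -/
theorem idx_eq_of_le {α ι : Type*} {idx : ℕ → α → ι}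
    (nest : ∀ k x y, idx (k + 1) x = idx (k + 1) y → idx k x = idx k y)
    {j k : ℕ} (hjk : j ≤ k) {x y : α} (h : idx k x = idx k y) : idx j x = idx j y := by
  induction k, hjk using Nat.le_induction with
  | base => exact h
  | succ k _ ih => exact ih (nest k x y h)

section Stopping

variable {α ι : Type*} [MeasurableSpace α]

/-- The level-`t` condition at generation `k`: the mean of `‖g‖` over the cell of `x` exceeds `t`. -/
def CellHit (μ : Measure α) (idx : ℕ → α → ι) (g : α → ℝ) (t : ℝ≥0∞) (k : ℕ) (x : α) : Prop :=
  t * μ (idx k ⁻¹' {idx k x}) < ∫⁻ y in idx k ⁻¹' {idx k x}, ‖g y‖ₑ ∂μ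

/-- The superlevel set of the maximal function associated with the nested partitions `idx`. -/
def maxSuperlevel (μ : Measure α) (idx : ℕ → α → ι) (g : α → ℝ) (t : ℝ≥0∞) : Set α :=
  {x | ∃ k, CellHit μ idx g t k x}

/-- The maximal cells over which the mean of `‖g‖` exceeds `t`. -/
def stoppingCells (μ : Measure α) (idx : ℕ → α → ι) (g : α → ℝ) (t : ℝ≥0∞) : Set (ℕ × ι) :=
  {P | ∃ x, idx P.1 x = P.2 ∧ CellHit μ idx g t P.1 x ∧ ∀ j < P.1, ¬ CellHit μ idx g t j x}

variable {μ : Measure α} {idx : ℕ → α → ι} {g : α → ℝ} {s t : ℝ≥0∞}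

theorem cellHit_congr {k : ℕ} {x y : α} (h : idx k x = idx k y) :
    CellHit μ idx g t k x ↔ CellHit μ idx g t k y := by
  simp only [CellHit, h]

theorem CellHit.anti (hst : t ≤ s) {k : ℕ} {x : α} (h : CellHit μ idx g s k x) :
    CellHit μ idx g t k x :=
  lt_of_le_of_lt (by gcongr) h

theorem stop_of_mem (nest : ∀ k x y, idx (k + 1) x = idx (k + 1) y → idx k x = idx k y)
    {P : ℕ × ι} (hP : P ∈ stoppingCells μ idx g t) {y : α} (hy : idx P.1 y = P.2) :
    CellHit μ idx g t P.1 y ∧ ∀ j < P.1, ¬ CellHit μ idx g t j y := by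
  obtain ⟨x, hx, hx1, hx2⟩ := hP
  have e : idx P.1 x = idx P.1 y := hx.trans hy.symm
  exact ⟨(cellHit_congr e).1 hx1, fun j hj h =>
    hx2 j hj ((cellHit_congr (idx_eq_of_le nest hj.le e)).2 h)⟩

theorem maxSuperlevel_eq_biUnion
    (nest : ∀ k x y, idx (k + 1) x = idx (k + 1) y → idx k x = idx k y) :
    maxSuperlevel μ idx g t = ⋃ P ∈ stoppingCells μ idx g t, idx P.1 ⁻¹' {P.2} := by
  classical
  ext x
  simp only [maxSuperlevel, mem_ofPred_eq, mem_iUnion, mem_preimage, mem_singleton_iff,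
    exists_prop]
  constructor
  · intro h
    exact ⟨(Nat.find h, idx (Nat.find h) x), ⟨x, rfl, Nat.find_spec h,
      fun j hj => Nat.find_min h hj⟩, rfl⟩
  · rintro ⟨P, hP, hx⟩
    exact ⟨P.1, (stop_of_mem nest hP hx).1⟩

theorem stoppingCells_pairwiseDisjoint
    (nest : ∀ k x y, idx (k + 1) x = idx (k + 1) y → idx k x = idx k y) :
    (stoppingCells μ idx g t).PairwiseDisjoint fun P => idx P.1 ⁻¹' {P.2} := by
  intro P hP R hR hne
  refine Set.disjoint_left.2 fun x hx hy => hne ?_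
  simp only [mem_preimage, mem_singleton_iff] at hx hy
  obtain ⟨h1, h2⟩ := stop_of_mem nest hP hx
  obtain ⟨h3, h4⟩ := stop_of_mem nest hR hy
  have e : P.1 = R.1 := by
    rcases lt_trichotomy P.1 R.1 with h | h | h
    · exact absurd h1 (h4 _ h)
    · exact h
    · exact absurd h3 (h2 _ h)
  exact Prod.ext e (by rw [← hx, ← hy, e])

/-- On a stopping cell at level `t`, the mean of `‖g‖` is at most `N * t`, where `N` is the
doubling constant of the nested partitions. -/
theorem lintegral_stoppingCell_le
    (nest : ∀ k x y, idx (k + 1) x = idx (k + 1) y → idx k x = idx k y)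
    {N : ℝ≥0∞}
    (doubling : ∀ k x, μ (idx k ⁻¹' {idx k x}) ≤ N * μ (idx (k + 1) ⁻¹' {idx (k + 1) x}))
    (h0 : ∀ x, ¬ CellHit μ idx g t 0 x)
    {P : ℕ × ι} (hP : P ∈ stoppingCells μ idx g t) :
    ∫⁻ y in idx P.1 ⁻¹' {P.2}, ‖g y‖ₑ ∂μ ≤ N * t * μ (idx P.1 ⁻¹' {P.2}) := by
  obtain ⟨k, m⟩ := P
  obtain ⟨x, hx, h1, h2⟩ := hP
  simp only at hx h1 h2 ⊢
  subst hx
  cases k with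
  | zero => exact absurd h1 (h0 x)
  | succ k =>
    have h3 := h2 k (Nat.lt_succ_self k)
    simp only [CellHit, not_lt] at h3
    calc ∫⁻ y in idx (k + 1) ⁻¹' {idx (k + 1) x}, ‖g y‖ₑ ∂μ
        ≤ ∫⁻ y in idx k ⁻¹' {idx k x}, ‖g y‖ₑ ∂μ :=
          lintegral_mono_set fun y hy => nest k y x hy
      _ ≤ t * μ (idx k ⁻¹' {idx k x}) := h3
      _ ≤ t * (N * μ (idx (k + 1) ⁻¹' {idx (k + 1) x})) := by gcongr; exact doubling k x
      _ = _ := by ring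

theorem measure_stoppingCell_ne_zero {P : ℕ × ι} (hP : P ∈ stoppingCells μ idx g t) :
    μ (idx P.1 ⁻¹' {P.2}) ≠ 0 := by
  obtain ⟨x, hx, h1, -⟩ := hP
  intro h
  rw [CellHit, hx, Measure.restrict_eq_zero.2 h] at h1
  simp at h1

/-- The part of the superlevel set at level `2 * u` inside a stopping cell is controlled by the
oscillation of `g` over that cell. -/
theorem mul_measure_maxSuperlevel_inter_le [Countable ι] [IsFiniteMeasure μ]
    (meas : ∀ k m, MeasurableSet (idx k ⁻¹' {m}))
    (nest : ∀ k x y, idx (k + 1) x = idx (k + 1) y → idx k x = idx k y)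
    {u : ℝ≥0∞} (hu : u ≠ ⊤) (htu : t ≤ 2 * u) {c : ℝ} (hc : ‖c‖ₑ ≤ u)
    {P : ℕ × ι} (hP : P ∈ stoppingCells μ idx g t) :
    u * μ (maxSuperlevel μ idx g (2 * u) ∩ idx P.1 ⁻¹' {P.2}) ≤
      ∫⁻ y in idx P.1 ⁻¹' {P.2}, ‖g y - c‖ₑ ∂μ := by
  have hdis := stoppingCells_pairwiseDisjoint (μ := μ) (g := g) (t := 2 * u) nest
  have hdis' : (stoppingCells μ idx g (2 * u)).PairwiseDisjoint
      fun R => idx R.1 ⁻¹' {R.2} ∩ idx P.1 ⁻¹' {P.2} := fun R hR R' hR' hne =>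
    (hdis hR hR' hne).mono inter_subset_left inter_subset_left
  have key : ∀ R ∈ stoppingCells μ idx g (2 * u),
      u * μ (idx R.1 ⁻¹' {R.2} ∩ idx P.1 ⁻¹' {P.2}) ≤
        ∫⁻ y in idx R.1 ⁻¹' {R.2} ∩ idx P.1 ⁻¹' {P.2}, ‖g y - c‖ₑ ∂μ := by
    intro R hR
    rcases Set.eq_empty_or_nonempty (idx R.1 ⁻¹' {R.2} ∩ idx P.1 ⁻¹' {P.2}) with h | ⟨x, hx, hx'⟩
    · simp [h]
    simp only [mem_preimage, mem_singleton_iff] at hx hx'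
    obtain ⟨h1, -⟩ := stop_of_mem nest hR hx
    obtain ⟨-, h4⟩ := stop_of_mem nest hP hx'
    have hle : P.1 ≤ R.1 := by
      by_contra! h
      exact h4 _ h (h1.anti htu)
    have hsub : idx R.1 ⁻¹' {R.2} ⊆ idx P.1 ⁻¹' {P.2} := by
      intro y hy
      simp only [mem_preimage, mem_singleton_iff] at hy ⊢
      rw [← hx']
      exact idx_eq_of_le nest hle (hy.trans hx.symm)
    rw [inter_eq_left.2 hsub]
    rw [CellHit, hx] at h1
    have h5 : ∫⁻ y in idx R.1 ⁻¹' {R.2}, ‖g y‖ₑ ∂μ ≤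
        (∫⁻ y in idx R.1 ⁻¹' {R.2}, ‖g y - c‖ₑ ∂μ) + u * μ (idx R.1 ⁻¹' {R.2}) := by
      calc ∫⁻ y in idx R.1 ⁻¹' {R.2}, ‖g y‖ₑ ∂μ
          ≤ ∫⁻ y in idx R.1 ⁻¹' {R.2}, (‖g y - c‖ₑ + u) ∂μ := by
            refine lintegral_mono fun y => ?_
            calc ‖g y‖ₑ = ‖(g y - c) + c‖ₑ := by simp
              _ ≤ ‖g y - c‖ₑ + ‖c‖ₑ := enorm_add_le _ _
              _ ≤ _ := by gcongr
        _ = _ := by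
            rw [lintegral_add_right _ measurable_const]; simp
    have h6 := h1.le.trans h5
    rw [mul_assoc, two_mul] at h6
    exact (ENNReal.add_le_add_iff_right
      (ENNReal.mul_ne_top hu (measure_ne_top μ _))).1 h6
  calc u * μ (maxSuperlevel μ idx g (2 * u) ∩ idx P.1 ⁻¹' {P.2})
      = u * ∑' R : stoppingCells μ idx g (2 * u),
          μ (idx R.1.1 ⁻¹' {R.1.2} ∩ idx P.1 ⁻¹' {P.2}) := by
        rw [maxSuperlevel_eq_biUnion nest, iUnion₂_inter, measure_biUnion (Set.to_countable _) hdis'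
          fun R _ => (meas _ _).inter (meas _ _)]
    _ ≤ ∑' R : stoppingCells μ idx g (2 * u),
          ∫⁻ y in idx R.1.1 ⁻¹' {R.1.2} ∩ idx P.1 ⁻¹' {P.2}, ‖g y - c‖ₑ ∂μ := by
        rw [← ENNReal.tsum_mul_left]
        exact ENNReal.tsum_le_tsum fun R => key R R.2
    _ = ∫⁻ y in ⋃ R ∈ stoppingCells μ idx g (2 * u),
          (idx R.1 ⁻¹' {R.2} ∩ idx P.1 ⁻¹' {P.2}), ‖g y - c‖ₑ ∂μ :=
        (lintegral_biUnion (Set.to_countable _) (fun R _ => (meas _ _).inter (meas _ _)) hdis' _).symm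
    _ ≤ _ := lintegral_mono_set (iUnion₂_subset fun R _ => inter_subset_right)

theorem min_le_add_rpow {r δ : ℝ≥0∞} {p : ℝ} (hp : 0 ≤ p) (hδ : δ ≠ 0) (hδ' : δ ≠ ⊤) :
    min 1 r ≤ δ + (r / δ) ^ p := by
  rcases le_total r δ with h | h
  · exact (min_le_right _ _).trans (h.trans le_self_add)
  · refine (min_le_left _ _).trans (le_trans ?_ le_add_self)
    rw [← ENNReal.one_rpow p]
    gcongr
    exact (ENNReal.le_div_iff_mul_le (.inl hδ) (.inl hδ')).2 (by simpa using h)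

/-- Good-`λ` inequality for the maximal function of the nested partitions, with the `p`-sum of
oscillations over disjoint cells bounded by `B`. -/
theorem measure_maxSuperlevel_le [Countable ι] [IsFiniteMeasure μ]
    (meas : ∀ k m, MeasurableSet (idx k ⁻¹' {m}))
    (nest : ∀ k x y, idx (k + 1) x = idx (k + 1) y → idx k x = idx k y)
    {N : ℝ≥0∞} (hN : 1 ≤ N) (hN' : N ≠ ⊤)
    (doubling : ∀ k x, μ (idx k ⁻¹' {idx k x}) ≤ N * μ (idx (k + 1) ⁻¹' {idx (k + 1) x}))
    (ht : t ≠ 0) (ht' : t ≠ ⊤) (h0 : ∀ x, ¬ CellHit μ idx g t 0 x)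
    {c : ℕ × ι → ℝ} {osc : ℕ × ι → ℝ≥0∞} {p : ℝ} (hp : 0 ≤ p) {B : ℝ≥0∞}
    (hosc : ∀ P, μ (idx P.1 ⁻¹' {P.2}) ≠ 0 →
      ∫⁻ y in idx P.1 ⁻¹' {P.2}, ‖g y - c P‖ₑ ∂μ ≤ μ (idx P.1 ⁻¹' {P.2}) * osc P)
    (hc : ∀ P, μ (idx P.1 ⁻¹' {P.2}) ≠ 0 →
      ‖c P‖ₑ * μ (idx P.1 ⁻¹' {P.2}) ≤ ∫⁻ y in idx P.1 ⁻¹' {P.2}, ‖g y‖ₑ ∂μ)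
    (hB : ∀ S : Set (ℕ × ι), (∀ P ∈ S, μ (idx P.1 ⁻¹' {P.2}) ≠ 0) →
      S.PairwiseDisjoint (fun P => idx P.1 ⁻¹' {P.2}) →
      ∑' P : S, μ (idx P.1.1 ⁻¹' {P.1.2}) * osc P ^ p ≤ B)
    {δ : ℝ≥0∞} (hδ : δ ≠ 0) (hδ' : δ ≠ ⊤) :
    μ (maxSuperlevel μ idx g (2 * N * t)) ≤
      δ * μ (maxSuperlevel μ idx g t) + B / (δ * t) ^ p := by
  have hNt : N * t ≠ 0 := mul_ne_zero (zero_lt_one.trans_le hN).ne' ht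
  have hNt' : N * t ≠ ⊤ := ENNReal.mul_ne_top hN' ht'
  have htN : t ≤ N * t := le_mul_of_one_le_left' hN
  have ht2 : t ≤ 2 * (N * t) := htN.trans (le_mul_of_one_le_left' (by norm_num))
  have hdis := stoppingCells_pairwiseDisjoint (μ := μ) (g := g) (t := t) nest
  have key : ∀ P ∈ stoppingCells μ idx g t,
      μ (maxSuperlevel μ idx g (2 * (N * t)) ∩ idx P.1 ⁻¹' {P.2}) ≤
        δ * μ (idx P.1 ⁻¹' {P.2}) + μ (idx P.1 ⁻¹' {P.2}) * osc P ^ p / (δ * t) ^ p := by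
    intro P hP
    have hP0 := measure_stoppingCell_ne_zero hP
    have hPt := measure_ne_top μ (idx P.1 ⁻¹' {P.2})
    have hcP : ‖c P‖ₑ ≤ N * t :=
      (ENNReal.mul_le_mul_iff_left hP0 hPt).1
        ((hc P hP0).trans (lintegral_stoppingCell_le nest doubling h0 hP))
    have h1 := (mul_measure_maxSuperlevel_inter_le meas nest hNt' ht2 hcP hP).trans (hosc P hP0)
    have h2 : μ (maxSuperlevel μ idx g (2 * (N * t)) ∩ idx P.1 ⁻¹' {P.2}) ≤
        μ (idx P.1 ⁻¹' {P.2}) * min 1 (osc P / t) := by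
      rw [mul_min, mul_one]
      refine le_min (measure_mono inter_subset_right) ?_
      rw [← mul_div_assoc, ENNReal.le_div_iff_mul_le (.inl ht) (.inl ht'), mul_comm]
      exact le_trans (by gcongr) h1
    refine h2.trans ?_
    calc μ (idx P.1 ⁻¹' {P.2}) * min 1 (osc P / t)
        ≤ μ (idx P.1 ⁻¹' {P.2}) * (δ + (osc P / t / δ) ^ p) := by
          gcongr; exact min_le_add_rpow hp hδ hδ'
      _ = _ := by
          have : osc P / t / δ = osc P / (δ * t) := by
            rw [div_eq_mul_inv, div_eq_mul_inv, div_eq_mul_inv, mul_assoc,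
              ENNReal.mul_inv (.inl hδ) (.inl hδ'), mul_comm δ⁻¹]
          rw [this, ENNReal.div_rpow_of_nonneg _ _ hp, mul_add, mul_comm _ δ, mul_div_assoc]
  have hsub : maxSuperlevel μ idx g (2 * (N * t)) ⊆ maxSuperlevel μ idx g t :=
    fun x ⟨k, hk⟩ => ⟨k, hk.anti ht2⟩
  have e1 : maxSuperlevel μ idx g (2 * (N * t)) = ⋃ P ∈ stoppingCells μ idx g t,
      maxSuperlevel μ idx g (2 * (N * t)) ∩ idx P.1 ⁻¹' {P.2} := by
    rw [← inter_iUnion₂, ← maxSuperlevel_eq_biUnion nest, inter_eq_left.2 hsub]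
  rw [mul_assoc, e1]
  refine (measure_biUnion_le _ (Set.to_countable _) _).trans ?_
  refine (ENNReal.tsum_le_tsum fun P : stoppingCells μ idx g t => key P P.2).trans ?_
  rw [ENNReal.tsum_add, ENNReal.tsum_mul_left]
  conv_rhs => rw [maxSuperlevel_eq_biUnion nest, measure_biUnion (Set.to_countable _) hdis
          fun R _ => meas _ _]
  gcongr
  simp only [div_eq_mul_inv]
  rw [ENNReal.tsum_mul_right]
  gcongr
  exact hB _ (fun P hP => measure_stoppingCell_ne_zero hP) hdis

end Stopping

/-- Iterating the good-`λ` inequality gives weak-type decay. -/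
theorem rpow_mul_le_of_goodLambda {m : ℝ → ℝ} {p c τ V B : ℝ} (hp : 0 < p) (hc : 1 < c)
    (hτ : 0 < τ) (hV : ∀ t, m t ≤ V) (hV0 : 0 ≤ V) (hB : τ ^ p * V ≤ B)
    (h : ∀ t, τ ≤ t → m (c * t) ≤ c ^ (-p) / 2 * m t + B / (c ^ (-p) / 2 * t) ^ p)
    {t : ℝ} (ht : 0 < t) : t ^ p * m t ≤ 2 * c ^ p * (2 * c ^ p) ^ p * B := by
  have hc0 : 0 < c := by linarith
  have hcp : 1 ≤ c ^ p := Real.one_le_rpow hc.le hp.le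
  have hE : 1 ≤ (2 * c ^ p) ^ p := Real.one_le_rpow (by linarith) hp.le
  have hB0 : 0 ≤ B := le_trans (by positivity) hB
  have main : ∀ j : ℕ, ∀ t, 0 < t → t ≤ c ^ (j + 1) * τ →
      t ^ p * m t ≤ 2 * c ^ p * (2 * c ^ p) ^ p * B := by
    intro j
    have base : ∀ t, 0 < t → t ≤ c * τ → t ^ p * m t ≤ 2 * c ^ p * (2 * c ^ p) ^ p * B := by
      intro t ht htc
      calc t ^ p * m t ≤ (c * τ) ^ p * V := by
            have := hV t
            have h1 : t ^ p ≤ (c * τ) ^ p := Real.rpow_le_rpow ht.le htc hp.le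
            calc t ^ p * m t ≤ t ^ p * V := by gcongr
              _ ≤ _ := by gcongr
        _ = c ^ p * (τ ^ p * V) := by rw [Real.mul_rpow hc0.le hτ.le]; ring
        _ ≤ c ^ p * B := by gcongr
        _ ≤ _ := by
            gcongr
            nlinarith
    induction j with
    | zero => simpa using base
    | succ j ih =>
      intro t ht htc
      rcases le_total t (c * τ) with h1 | h1
      · exact base t ht h1
      obtain ⟨u, rfl⟩ : ∃ u, t = c * u := ⟨t / c, by field_simp⟩
      have hu : 0 < u := pos_of_mul_pos_right ht hc0.le
      have huτ : τ ≤ u := le_of_mul_le_mul_left h1 hc0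
      have hu2 : u ≤ c ^ (j + 1) * τ := by
        refine le_of_mul_le_mul_left ?_ hc0
        calc c * u ≤ _ := htc
          _ = _ := by ring
      have h2 := ih u hu hu2
      have hδ : c ^ (-p) / 2 = (2 * c ^ p)⁻¹ := by
        rw [Real.rpow_neg hc0.le]; field_simp
      have h3 : (c * u) ^ p * m (c * u) ≤
          1 / 2 * (u ^ p * m u) + c ^ p * (2 * c ^ p) ^ p * B := by
        calc (c * u) ^ p * m (c * u) ≤
            (c * u) ^ p * (c ^ (-p) / 2 * m u + B / (c ^ (-p) / 2 * u) ^ p) := by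
              gcongr; exact h u huτ
          _ = _ := by
              have hup : u ^ p ≠ 0 := (Real.rpow_pos_of_pos hu p).ne'
              have hcp' : c ^ p ≠ 0 := by positivity
              have hE' : (2 * c ^ p) ^ p ≠ 0 := by positivity
              rw [hδ, Real.mul_rpow hc0.le hu.le, Real.mul_rpow (by positivity) hu.le,
                Real.inv_rpow (by positivity)]
              field_simp
      linarith
  obtain ⟨j, hj⟩ := pow_unbounded_of_one_lt (t / τ) hc
  refine main j t ht ?_
  rw [div_lt_iff₀ hτ] at hj
  refine hj.le.trans ?_
  gcongr
  · exact hc.le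
  · omega

/-- The closed cube with lower corner `a` and side `l`. -/
def axisCube {n : ℕ} (a : Fin n → ℝ) (l : ℝ) : Set (Fin n → ℝ) :=
  Set.univ.pi fun i => Set.Icc (a i) (a i + l)

/-- The half-open cube with lower corner `a` and side `l`. -/
def halfOpenCube {n : ℕ} (a : Fin n → ℝ) (l : ℝ) : Set (Fin n → ℝ) :=
  Set.univ.pi fun i => Set.Ico (a i) (a i + l)

section Cubes

variable {n : ℕ} {a : Fin n → ℝ} {l : ℝ}

theorem isCube_axisCube (hl : 0 < l) : IsCube (axisCube a l) := ⟨a, l, hl, rfl⟩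

theorem measurableSet_axisCube : MeasurableSet (axisCube a l) :=
  MeasurableSet.univ_pi fun _ => measurableSet_Icc

theorem measurableSet_halfOpenCube : MeasurableSet (halfOpenCube a l) :=
  MeasurableSet.univ_pi fun _ => measurableSet_Ico

theorem halfOpenCube_ae_eq : halfOpenCube a l =ᵐ[volume] axisCube a l :=
  Measure.pi_Ico_ae_eq_pi_Icc

theorem halfOpenCube_subset : halfOpenCube a l ⊆ axisCube a l :=
  Set.pi_mono fun _ _ => Ico_subset_Icc_self

theorem isClosed_axisCube : IsClosed (axisCube a l) :=
  isClosed_set_pi fun _ _ => isClosed_Icc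

theorem interior_axisCube_subset : interior (axisCube a l) ⊆ halfOpenCube a l := by
  rw [axisCube, interior_pi_set Set.finite_univ]
  exact Set.pi_mono fun i _ => by rw [interior_Icc]; exact Ioo_subset_Ico_self

theorem axisCube_eq_closure (hl : 0 < l) : axisCube a l = closure (halfOpenCube a l) := by
  rw [halfOpenCube, closure_pi_set, axisCube]
  congr 1
  ext1 i
  rw [closure_Ico]
  linarith

theorem volume_axisCube : volume (axisCube a l) = ENNReal.ofReal l ^ n := by
  rw [axisCube, Set.pi_univ_Icc, Real.volume_Icc_pi]
  simp

theorem volume_axisCube_ne_top : volume (axisCube a l) ≠ ⊤ := by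
  rw [volume_axisCube]; exact ENNReal.pow_ne_top ENNReal.ofReal_ne_top

theorem volume_axisCube_ne_zero (hl : 0 < l) : volume (axisCube a l) ≠ 0 := by
  rw [volume_axisCube]; exact pow_ne_zero _ (by simpa using hl)

theorem axisCube_eq_closedBall (hl : 0 ≤ l) :
    axisCube a l = Metric.closedBall (fun i => a i + l / 2) (l / 2) := by
  rw [closedBall_pi _ (by linarith), axisCube]
  congr 1
  ext1 i
  rw [Real.closedBall_eq_Icc]
  congr 1 <;> ring

end Cubes

section Oscillation

variable {n : ℕ} {a : Fin n → ℝ} {l : ℝ} {f : (Fin n → ℝ) → ℝ}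

theorem volume_mul_ofReal_meanOsc {Q : Set (Fin n → ℝ)} (h0 : volume Q ≠ 0) (h1 : volume Q ≠ ⊤)
    (hf : IntegrableOn f Q) :
    volume Q * ENNReal.ofReal (meanOsc f Q) = ∫⁻ x in Q, ‖f x - cubeAvg f Q‖ₑ := by
  have hi : IntegrableOn (fun x => f x - cubeAvg f Q) Q :=
    hf.sub (integrableOn_const h1)
  have hpos : 0 < (volume Q).toReal := ENNReal.toReal_pos h0 h1
  have e := ofReal_integral_norm_eq_lintegral_enorm hi
  simp only [Real.norm_eq_abs] at e
  rw [← e, meanOsc, setAverage_eq, smul_eq_mul, measureReal_def,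
    ENNReal.ofReal_mul (by positivity), ENNReal.ofReal_inv_of_pos hpos, ENNReal.ofReal_toReal h1,
    ← mul_assoc, ENNReal.mul_inv_cancel h0 h1, one_mul]

theorem enorm_cubeAvg_sub_mul_le {Q : Set (Fin n → ℝ)} (h0 : volume Q ≠ 0) (h1 : volume Q ≠ ⊤)
    (hf : IntegrableOn f Q) (c : ℝ) :
    ‖cubeAvg f Q - c‖ₑ * volume Q ≤ ∫⁻ x in Q, ‖f x - c‖ₑ := by
  have hpos : 0 < (volume Q).toReal := ENNReal.toReal_pos h0 h1
  have e : ∫ x in Q, (f x - c) = (cubeAvg f Q - c) * (volume Q).toReal := by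
    rw [integral_sub hf (integrableOn_const h1), setIntegral_const, cubeAvg, setAverage_eq,
      smul_eq_mul, smul_eq_mul, measureReal_def]
    field_simp
  have e2 := enorm_integral_le_lintegral_enorm (μ := volume.restrict Q) (fun x => f x - c)
  rw [e, enorm_mul] at e2
  convert e2 using 2
  rw [Real.enorm_of_nonneg hpos.le, ENNReal.ofReal_toReal h1]

/-- The JN functional bounds sums over packings indexed by any countably infinite type. -/
theorem tsum_le_JN_rpow {κ : Type*} [Countable κ] [Infinite κ] {p : ℝ} (hp : 0 < p)
    {Q₀ : Set (Fin n → ℝ)} {Q : κ → Set (Fin n → ℝ)}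
    (hQ : ∀ i, IsCube (Q i) ∧ Q i ⊆ Q₀)
    (hdis : Pairwise fun i j => interior (Q i) ∩ interior (Q j) = ∅) :
    ∑' i, volume (Q i) * ENNReal.ofReal (meanOsc f (Q i)) ^ p ≤ JN p f Q₀ ^ p := by
  obtain ⟨hκ⟩ := nonempty_denumerable κ
  let e : κ ≃ ℕ := Denumerable.eqv κ
  rw [← e.symm.tsum_eq]
  have h : IsPackingIn Q₀ fun i => Q (e.symm i) :=
    ⟨fun i => hQ _, fun i j hij => hdis (e.symm.injective.ne hij)⟩
  have h2 := le_iSup₂ (f := fun (Q : ℕ → Set (Fin n → ℝ)) (_ : IsPackingIn Q₀ Q) =>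
    (∑' i, volume (Q i) * ENNReal.ofReal (meanOsc f (Q i)) ^ p) ^ (1 / p)) _ h
  have h3 := ENNReal.rpow_le_rpow h2 hp.le
  rwa [← ENNReal.rpow_mul, one_div_mul_cancel hp.ne', ENNReal.rpow_one] at h3

/-- A sequence of diagonal subcubes of `axisCube a l`, the first of side `l * (1 - η)`. -/
def diagCube (a : Fin n → ℝ) (l η : ℝ) (k : ℕ) : Set (Fin n → ℝ) :=
  axisCube (fun i => a i + l * (1 - η ^ k)) (l * (η ^ k - η ^ (k + 1)))

theorem diagCube_zero (η : ℝ) : diagCube a l η 0 = axisCube a (l * (1 - η)) := by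
  simp [diagCube]

theorem diagCube_side_pos (hl : 0 < l) {η : ℝ} (h0 : 0 < η) (h1 : η < 1) (k : ℕ) :
    0 < l * (η ^ k - η ^ (k + 1)) :=
  mul_pos hl (sub_pos.2 (pow_lt_pow_right_of_lt_one₀ h0 h1 (Nat.lt_succ_self k)))

theorem diagCube_subset (hl : 0 < l) {η : ℝ} (h0 : 0 < η) (h1 : η < 1) (k : ℕ) :
    diagCube a l η k ⊆ axisCube a l := by
  refine Set.pi_mono fun i _ => Icc_subset_Icc ?_ ?_
  · have : η ^ k ≤ 1 := pow_le_one₀ h0.le h1.le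
    nlinarith
  · have : 0 < η ^ (k + 1) := pow_pos h0 _
    nlinarith

theorem diagCube_interior_disjoint [NeZero n] (hl : 0 < l) {η : ℝ} (h0 : 0 < η) (h1 : η < 1) :
    Pairwise fun i j => interior (diagCube a l η i) ∩ interior (diagCube a l η j) = ∅ := by
  have aux : ∀ i j, i < j → interior (diagCube a l η i) ∩ interior (diagCube a l η j) = ∅ := by
    intro i j hij
    refine Set.eq_empty_of_forall_notMem fun x ⟨hx, hy⟩ => ?_
    have h2 := (interior_axisCube_subset hx 0 (mem_univ _)).2
    have h3 := (interior_axisCube_subset hy 0 (mem_univ _)).1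
    have h4 : η ^ j ≤ η ^ (i + 1) := pow_le_pow_of_le_one h0.le h1.le hij
    nlinarith
  intro i j hij
  rcases lt_or_gt_of_ne hij with h | h
  · exact aux i j h
  · rw [inter_comm]; exact aux j i h

open Filter Topology in
theorem tendsto_indicator_axisCube (hl : 0 < l) {F : ℝ → (Fin n → ℝ) → ℝ} {G : (Fin n → ℝ) → ℝ}
    (hF : ∀ x, Tendsto (fun η => F η x) (𝓝[>] 0) (𝓝 (G x))) (x : Fin n → ℝ) :
    Tendsto (fun η => (axisCube a (l * (1 - η))).indicator (F η) x) (𝓝[>] 0)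
      (𝓝 ((halfOpenCube a l).indicator G x)) := by
  by_cases hx : x ∈ halfOpenCube a l
  · rw [indicator_of_mem hx]
    refine (hF x).congr' ?_
    have h : ∀ᶠ η in 𝓝[>] (0 : ℝ), ∀ i, x i ≤ a i + l * (1 - η) := by
      refine eventually_all.2 fun i => ?_
      have h1 : Tendsto (fun η : ℝ => a i + l * (1 - η)) (𝓝[>] 0) (𝓝 (a i + l * (1 - 0))) :=
        (Continuous.tendsto (by fun_prop) 0).mono_left nhdsWithin_le_nhds
      have h2 := (hx i (mem_univ _)).2
      exact (h1.eventually (lt_mem_nhds (by linarith))).mono fun _ h => h.le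
    filter_upwards [h] with η hη
    rw [indicator_of_mem]
    exact fun i _ => ⟨(hx i (mem_univ _)).1, hη i⟩
  · rw [indicator_of_notMem hx]
    refine tendsto_const_nhds.congr' ?_
    filter_upwards [self_mem_nhdsWithin] with η hη
    rw [indicator_of_notMem]
    intro h
    refine hx fun i _ => ⟨(h i (mem_univ _)).1, (h i (mem_univ _)).2.trans_lt ?_⟩
    have : 0 < η := hη
    nlinarith

open Filter Topology in
theorem tendsto_setIntegral_axisCube (hl : 0 < l) {F : ℝ → (Fin n → ℝ) → ℝ}
    {G : (Fin n → ℝ) → ℝ} {b : (Fin n → ℝ) → ℝ}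
    (hF : ∀ x, Tendsto (fun η => F η x) (𝓝[>] 0) (𝓝 (G x)))
    (hm : ∀ η, AEStronglyMeasurable (F η) (volume.restrict (axisCube a l)))
    (hb : ∀ᶠ η in 𝓝[>] (0 : ℝ), ∀ x, ‖F η x‖ ≤ b x) (hbi : IntegrableOn b (axisCube a l)) :
    Tendsto (fun η => ∫ x in axisCube a (l * (1 - η)), F η x) (𝓝[>] 0)
      (𝓝 (∫ x in axisCube a l, G x)) := by
  have hsub : ∀ η : ℝ, 0 < η → axisCube a (l * (1 - η)) ⊆ axisCube a l := fun η hη =>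
    Set.pi_mono fun i _ => Icc_subset_Icc le_rfl (by nlinarith)
  rw [← setIntegral_congr_set halfOpenCube_ae_eq, ← integral_indicator measurableSet_halfOpenCube]
  simp_rw [← integral_indicator measurableSet_axisCube]
  refine tendsto_integral_filter_of_dominated_convergence ((axisCube a l).indicator b) ?_ ?_
    (hbi.integrable_indicator measurableSet_axisCube) (Eventually.of_forall
      (tendsto_indicator_axisCube hl hF))
  · filter_upwards [self_mem_nhdsWithin] with η hη
    rw [aestronglyMeasurable_indicator_iff measurableSet_axisCube]
    exact (hm η).mono_measure (Measure.restrict_mono (hsub η hη) le_rfl)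
  · filter_upwards [self_mem_nhdsWithin, hb] with η hη h
    refine Eventually.of_forall fun x => ?_
    rw [norm_indicator_eq_indicator_norm]
    refine (indicator_le_indicator (h x)).trans ?_
    exact indicator_le_indicator_of_subset (hsub η hη) (fun x => (norm_nonneg _).trans (h x)) x

open Filter Topology in
theorem tendsto_volume_axisCube :
    Tendsto (fun η => volume (axisCube a (l * (1 - η)))) (𝓝[>] 0)
      (𝓝 (volume (axisCube a l))) := by
  simp only [volume_axisCube]
  have h : Tendsto (fun η : ℝ => l * (1 - η)) (𝓝[>] 0) (𝓝 l) := by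
    have h1 : Tendsto (fun η : ℝ => l * (1 - η)) (𝓝[>] 0) (𝓝 (l * (1 - 0))) :=
        (Continuous.tendsto (by fun_prop) 0).mono_left nhdsWithin_le_nhds
    simpa using h1
  exact ENNReal.Tendsto.pow (ENNReal.tendsto_ofReal h)

open Filter Topology in
theorem tendsto_setAverage_axisCube (hl : 0 < l) {F : ℝ → (Fin n → ℝ) → ℝ}
    {G : (Fin n → ℝ) → ℝ} {b : (Fin n → ℝ) → ℝ}
    (hF : ∀ x, Tendsto (fun η => F η x) (𝓝[>] 0) (𝓝 (G x)))
    (hm : ∀ η, AEStronglyMeasurable (F η) (volume.restrict (axisCube a l)))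
    (hb : ∀ᶠ η in 𝓝[>] (0 : ℝ), ∀ x, ‖F η x‖ ≤ b x) (hbi : IntegrableOn b (axisCube a l)) :
    Tendsto (fun η => ⨍ x in axisCube a (l * (1 - η)), F η x) (𝓝[>] 0)
      (𝓝 (⨍ x in axisCube a l, G x)) := by
  simp only [setAverage_eq, measureReal_def, smul_eq_mul]
  refine Tendsto.mul (Tendsto.inv₀ ?_ ?_) (tendsto_setIntegral_axisCube hl hF hm hb hbi)
  · exact (ENNReal.tendsto_toReal volume_axisCube_ne_top).comp tendsto_volume_axisCube
  · exact (ENNReal.toReal_pos (volume_axisCube_ne_zero hl) volume_axisCube_ne_top).ne'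

open Filter Topology in
theorem tendsto_meanOsc_axisCube (hl : 0 < l) (hf : IntegrableOn f (axisCube a l)) :
    Tendsto (fun η => meanOsc f (axisCube a (l * (1 - η)))) (𝓝[>] 0)
      (𝓝 (meanOsc f (axisCube a l))) := by
  have hc : Tendsto (fun η => cubeAvg f (axisCube a (l * (1 - η)))) (𝓝[>] 0)
      (𝓝 (cubeAvg f (axisCube a l))) :=
    tendsto_setAverage_axisCube hl (F := fun _ => f) (b := fun x => ‖f x‖)
      (fun x => tendsto_const_nhds) (fun _ => hf.aestronglyMeasurable)
      (Eventually.of_forall fun _ _ => le_rfl) hf.norm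
  refine tendsto_setAverage_axisCube hl
    (F := fun η x => |f x - cubeAvg f (axisCube a (l * (1 - η)))|)
    (b := fun x => ‖f x‖ + (|cubeAvg f (axisCube a l)| + 1))
    (fun x => (tendsto_const_nhds.sub hc).abs)
    (fun η => (hf.aestronglyMeasurable.sub aestronglyMeasurable_const).norm) ?_
    (hf.norm.add (integrableOn_const volume_axisCube_ne_top))
  have h1 := hc.abs.eventually (gt_mem_nhds (lt_add_one _))
  filter_upwards [h1] with η h x
  rw [Real.norm_eq_abs, abs_abs, Real.norm_eq_abs]
  exact (abs_sub _ _).trans (by linarith)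

open Filter Topology in
/-- The JN functional bounds sums over packings indexed by any countable type. -/
theorem tsum_axisCube_le_JN_rpow [NeZero n] {κ : Type*} [Countable κ] {p : ℝ} (hp : 0 < p)
    {Q₀ : Set (Fin n → ℝ)} (hf : IntegrableOn f Q₀) {a : κ → Fin n → ℝ} {l : κ → ℝ}
    (hl : ∀ i, 0 < l i) (hQ : ∀ i, axisCube (a i) (l i) ⊆ Q₀)
    (hdis : Pairwise fun i j =>
      interior (axisCube (a i) (l i)) ∩ interior (axisCube (a j) (l j)) = ∅) :
    ∑' i, volume (axisCube (a i) (l i)) * ENNReal.ofReal (meanOsc f (axisCube (a i) (l i))) ^ p ≤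
      JN p f Q₀ ^ p := by
  rcases isEmpty_or_nonempty κ with hκ | hκ
  · simp
  rw [ENNReal.tsum_eq_iSup_sum]
  refine iSup_le fun s => ?_
  have hlim : Tendsto (fun η => ∑ i ∈ s, volume (axisCube (a i) (l i * (1 - η))) *
      ENNReal.ofReal (meanOsc f (axisCube (a i) (l i * (1 - η)))) ^ p) (𝓝[>] 0)
      (𝓝 (∑ i ∈ s, volume (axisCube (a i) (l i)) *
        ENNReal.ofReal (meanOsc f (axisCube (a i) (l i))) ^ p)) := by
    refine tendsto_finsetSum _ fun i _ => ?_
    refine ENNReal.Tendsto.mul tendsto_volume_axisCube (.inl (volume_axisCube_ne_zero (hl i))) ?_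
      (.inr volume_axisCube_ne_top)
    exact (ENNReal.tendsto_ofReal
      (tendsto_meanOsc_axisCube (hl i) (hf.mono_set (hQ i)))).ennrpow_const p
  refine le_of_tendsto hlim ?_
  filter_upwards [Ioo_mem_nhdsGT (zero_lt_one (α := ℝ))] with η hη
  have h1 : ∑' q : κ × ℕ, volume (diagCube (a q.1) (l q.1) η q.2) *
      ENNReal.ofReal (meanOsc f (diagCube (a q.1) (l q.1) η q.2)) ^ p ≤ JN p f Q₀ ^ p := by
    refine tsum_le_JN_rpow hp (fun q => ⟨isCube_axisCube (diagCube_side_pos (hl q.1) hη.1 hη.2 q.2),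
      (diagCube_subset (hl q.1) hη.1 hη.2 q.2).trans (hQ q.1)⟩) ?_
    rintro ⟨i, k⟩ ⟨j, m⟩ hne
    by_cases hij : i = j
    · subst hij
      exact diagCube_interior_disjoint (hl i) hη.1 hη.2 (fun h => hne (Prod.ext rfl h))
    · refine Set.subset_empty_iff.1 ((inter_subset_inter ?_ ?_).trans (hdis hij).subset)
      · exact interior_mono (diagCube_subset (hl i) hη.1 hη.2 k)
      · exact interior_mono (diagCube_subset (hl j) hη.1 hη.2 m)
  refine le_trans ?_ h1
  rw [ENNReal.tsum_prod (f := fun i k => volume (diagCube (a i) (l i) η k) *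
    ENNReal.ofReal (meanOsc f (diagCube (a i) (l i) η k)) ^ p)]
  refine le_trans (Finset.sum_le_sum fun i _ => ?_) (ENNReal.sum_le_tsum s)
  rw [← diagCube_zero]
  exact ENNReal.le_tsum 0

end Oscillation

section Dyadic

variable {n : ℕ} {a : Fin n → ℝ} {l : ℝ}

/-- The index of the dyadic cell of generation `k` containing `x`. -/
def dyadicIdx (a : Fin n → ℝ) (l : ℝ) (k : ℕ) (x : Fin n → ℝ) : Fin n → ℤ :=
  fun i => ⌊(x i - a i) / l * 2 ^ k⌋

/-- The lower corner of a dyadic cell. -/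
def dyadicCorner (a : Fin n → ℝ) (l : ℝ) (P : ℕ × (Fin n → ℤ)) : Fin n → ℝ :=
  fun i => a i + l / 2 ^ P.1 * P.2 i

/-- The closed dyadic cube. -/
def dyadicCube (a : Fin n → ℝ) (l : ℝ) (P : ℕ × (Fin n → ℤ)) : Set (Fin n → ℝ) :=
  axisCube (dyadicCorner a l P) (l / 2 ^ P.1)

theorem preimage_dyadicIdx (hl : 0 < l) (P : ℕ × (Fin n → ℤ)) :
    dyadicIdx a l P.1 ⁻¹' {P.2} = halfOpenCube (dyadicCorner a l P) (l / 2 ^ P.1) := by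
  ext x
  simp only [mem_preimage, mem_singleton_iff, funext_iff, halfOpenCube, mem_univ_pi, mem_Ico,
    dyadicIdx, dyadicCorner, Int.floor_eq_iff]
  refine forall_congr' fun i => ?_
  have h2 : (0 : ℝ) < 2 ^ P.1 := by positivity
  have e : (x i - a i) / l * 2 ^ P.1 = (x i - a i) / (l / 2 ^ P.1) := by field_simp
  have hd : 0 < l / 2 ^ P.1 := by positivity
  rw [e, le_div_iff₀ hd, div_lt_iff₀ hd]
  constructor <;> rintro ⟨h, h'⟩ <;> constructor <;> linarith

theorem measurableSet_preimage_dyadicIdx (hl : 0 < l) (k : ℕ) (m : Fin n → ℤ) :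
    MeasurableSet (dyadicIdx a l k ⁻¹' {m}) := by
  rw [preimage_dyadicIdx hl (k, m)]
  exact measurableSet_halfOpenCube

theorem dyadicIdx_nest (k : ℕ) (x y : Fin n → ℝ)
    (h : dyadicIdx a l (k + 1) x = dyadicIdx a l (k + 1) y) :
    dyadicIdx a l k x = dyadicIdx a l k y := by
  have e : ∀ (z : Fin n → ℝ) i, dyadicIdx a l k z i = dyadicIdx a l (k + 1) z i / 2 := by
    intro z i
    have := Int.floor_div_natCast ((z i - a i) / l * 2 ^ (k + 1)) 2
    simp only [dyadicIdx]
    rw [Nat.cast_ofNat, Nat.cast_ofNat] at this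
    rw [← this, pow_succ]
    congr 1
    ring
  ext i
  rw [e, e, h]

theorem dyadicIdx_zero_preimage (hl : 0 < l) :
    dyadicIdx a l 0 ⁻¹' {0} = halfOpenCube a l := by
  rw [preimage_dyadicIdx hl (0, 0)]
  have h : dyadicCorner a l (0, 0) = a := by ext i; simp [dyadicCorner]
  simp [h]

theorem dyadicCube_zero : dyadicCube a l (0, 0) = axisCube a l := by
  have h : dyadicCorner a l (0, 0) = a := by ext i; simp [dyadicCorner]
  simp [dyadicCube, h]

theorem dyadicCell_subset (hl : 0 < l) {P : ℕ × (Fin n → ℤ)} {x : Fin n → ℝ}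
    (hx : x ∈ halfOpenCube a l) (hxP : dyadicIdx a l P.1 x = P.2) :
    dyadicIdx a l P.1 ⁻¹' {P.2} ⊆ halfOpenCube a l := by
  rw [← dyadicIdx_zero_preimage hl] at hx ⊢
  intro y hy
  exact (idx_eq_of_le dyadicIdx_nest (Nat.zero_le _) (hy.trans hxP.symm)).trans hx

theorem dyadicCell_ae_eq (hl : 0 < l) (P : ℕ × (Fin n → ℤ)) :
    (dyadicIdx a l P.1 ⁻¹' {P.2} : Set (Fin n → ℝ)) =ᵐ[volume] dyadicCube a l P := by
  rw [preimage_dyadicIdx hl]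
  exact halfOpenCube_ae_eq

theorem dyadicCube_subset (hl : 0 < l) {P : ℕ × (Fin n → ℤ)}
    (h : dyadicIdx a l P.1 ⁻¹' {P.2} ⊆ halfOpenCube a l) :
    dyadicCube a l P ⊆ axisCube a l := by
  rw [dyadicCube, axisCube_eq_closure (by positivity), ← preimage_dyadicIdx hl]
  exact closure_minimal (h.trans halfOpenCube_subset) isClosed_axisCube

theorem subset_of_measure_ne_zero (hl : 0 < l) {P : ℕ × (Fin n → ℤ)}
    (h : volume.restrict (halfOpenCube a l) (dyadicIdx a l P.1 ⁻¹' {P.2}) ≠ 0) :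
    dyadicIdx a l P.1 ⁻¹' {P.2} ⊆ halfOpenCube a l := by
  rw [Measure.restrict_apply (measurableSet_preimage_dyadicIdx hl _ _)] at h
  obtain ⟨x, hx, hx'⟩ := nonempty_of_measure_ne_zero h
  exact dyadicCell_subset hl hx' hx

theorem restrict_dyadicCell (hl : 0 < l) {P : ℕ × (Fin n → ℤ)}
    (h : dyadicIdx a l P.1 ⁻¹' {P.2} ⊆ halfOpenCube a l) :
    (volume.restrict (halfOpenCube a l)).restrict (dyadicIdx a l P.1 ⁻¹' {P.2}) =
      volume.restrict (dyadicCube a l P) := by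
  rw [Measure.restrict_restrict_of_subset h, Measure.restrict_congr_set (dyadicCell_ae_eq hl P)]

theorem measure_dyadicCell (hl : 0 < l) {P : ℕ × (Fin n → ℤ)}
    (h : dyadicIdx a l P.1 ⁻¹' {P.2} ⊆ halfOpenCube a l) :
    volume.restrict (halfOpenCube a l) (dyadicIdx a l P.1 ⁻¹' {P.2}) =
      volume (dyadicCube a l P) := by
  rw [← Measure.restrict_apply_univ, restrict_dyadicCell hl h, Measure.restrict_apply_univ]

theorem dyadic_doubling (hl : 0 < l) (k : ℕ) (x : Fin n → ℝ) :
    volume.restrict (halfOpenCube a l) (dyadicIdx a l k ⁻¹' {dyadicIdx a l k x}) ≤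
      2 ^ n * volume.restrict (halfOpenCube a l)
        (dyadicIdx a l (k + 1) ⁻¹' {dyadicIdx a l (k + 1) x}) := by
  by_cases h : volume.restrict (halfOpenCube a l) (dyadicIdx a l k ⁻¹' {dyadicIdx a l k x}) = 0
  · rw [h]; exact zero_le
  have h1 := subset_of_measure_ne_zero hl (P := (k, dyadicIdx a l k x)) h
  have hx : x ∈ halfOpenCube a l := h1 rfl
  have h2 := dyadicCell_subset hl (P := (k + 1, dyadicIdx a l (k + 1) x)) hx rfl
  rw [measure_dyadicCell hl (P := (k, dyadicIdx a l k x)) h1,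
    measure_dyadicCell hl (P := (k + 1, dyadicIdx a l (k + 1) x)) h2]
  rw [dyadicCube, dyadicCube, volume_axisCube, volume_axisCube, ← mul_pow]
  refine le_of_eq ?_
  congr 1
  rw [← ENNReal.ofReal_ofNat 2, ← ENNReal.ofReal_mul (by norm_num)]
  congr 1
  simp only [pow_succ]
  field_simp

theorem ofReal_mul_volume_lt {Q : Set (Fin n → ℝ)} (h0 : volume Q ≠ 0) (h1 : volume Q ≠ ⊤)
    {g : (Fin n → ℝ) → ℝ} (hg : IntegrableOn g Q) {s : ℝ} (hs : 0 ≤ s)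
    (h : s < ⨍ x in Q, ‖g x‖) :
    ENNReal.ofReal s * volume Q < ∫⁻ x in Q, ‖g x‖ₑ := by
  have hpos : 0 < (volume Q).toReal := ENNReal.toReal_pos h0 h1
  rw [← ofReal_integral_norm_eq_lintegral_enorm hg, ← ENNReal.ofReal_toReal h1,
    ← ENNReal.ofReal_mul hs]
  rw [setAverage_eq, smul_eq_mul, measureReal_def, inv_mul_eq_div, lt_div_iff₀ hpos] at h
  exact (ENNReal.ofReal_lt_ofReal_iff (lt_of_le_of_lt (by positivity) h)).2 h

open Filter Topology in
/-- Almost every point where `|g| > s` lies in the level-`s` superlevel set of the dyadic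
maximal function. -/
theorem ae_mem_maxSuperlevel (hl : 0 < l) {g : (Fin n → ℝ) → ℝ}
    (hg : IntegrableOn g (axisCube a l)) :
    ∀ᵐ x ∂volume.restrict (halfOpenCube a l), ∀ s : ℝ, 0 ≤ s → s < |g x| →
      x ∈ maxSuperlevel (volume.restrict (halfOpenCube a l)) (dyadicIdx a l) g
        (ENNReal.ofReal s) := by
  have hloc : LocallyIntegrable ((axisCube a l).indicator fun x => ‖g x‖) volume :=
    ((integrable_indicator_iff measurableSet_axisCube).2 hg.norm).locallyIntegrable
  rw [ae_restrict_iff' measurableSet_halfOpenCube]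
  filter_upwards [IsUnifLocDoublingMeasure.ae_tendsto_average volume hloc 1] with x hx hxH s hs hsx
  let P : ℕ → ℕ × (Fin n → ℤ) := fun k => (k, dyadicIdx a l k x)
  have hcell : ∀ k, dyadicIdx a l (P k).1 ⁻¹' {(P k).2} ⊆ halfOpenCube a l :=
    fun k => dyadicCell_subset hl hxH rfl
  have hd : ∀ k : ℕ, 0 < l / 2 ^ k := fun k => by positivity
  have hball : ∀ k, dyadicCube a l (P k) = Metric.closedBall
      (fun i => dyadicCorner a l (P k) i + l / 2 ^ k / 2) (l / 2 ^ k / 2) :=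
    fun k => axisCube_eq_closedBall (hd k).le
  have hδ : Tendsto (fun k : ℕ => l / 2 ^ k / 2) atTop (𝓝[>] 0) := by
    refine tendsto_nhdsWithin_iff.2 ⟨?_, Eventually.of_forall fun k => half_pos (hd k)⟩
    have h1 : Tendsto (fun k : ℕ => l / 2 * (1 / 2 : ℝ) ^ k) atTop (𝓝 (l / 2 * 0)) :=
      (tendsto_pow_atTop_nhds_zero_of_lt_one (by norm_num) (by norm_num)).const_mul _
    rw [mul_zero] at h1
    refine h1.congr fun k => ?_
    rw [one_div, inv_pow]; ring
  have hlim := hx _ _ hδ (Eventually.of_forall fun k => by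
    rw [one_mul, ← hball, dyadicCube]
    have : x ∈ dyadicIdx a l (P k).1 ⁻¹' {(P k).2} := rfl
    rw [preimage_dyadicIdx hl] at this
    exact halfOpenCube_subset this)
  rw [indicator_of_mem (halfOpenCube_subset hxH)] at hlim
  obtain ⟨k, hk⟩ := (hlim.eventually (lt_mem_nhds hsx)).exists
  rw [← hball] at hk
  have hsub := dyadicCube_subset hl (hcell k)
  have havg : ⨍ y in dyadicCube a l (P k), (axisCube a l).indicator (fun x => ‖g x‖) y =
      ⨍ y in dyadicCube a l (P k), ‖g y‖ :=
    setAverage_congr_fun measurableSet_axisCube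
      (Eventually.of_forall fun y hy => indicator_of_mem (hsub hy) _)
  rw [havg] at hk
  refine ⟨k, ?_⟩
  rw [CellHit, measure_dyadicCell hl (hcell k), restrict_dyadicCell hl (hcell k)]
  exact ofReal_mul_volume_lt (volume_axisCube_ne_zero (hd k)) volume_axisCube_ne_top
    (hg.mono_set hsub) hs hk

end Dyadic

section Embedding

variable {n : ℕ} {a : Fin n → ℝ} {l : ℝ} {f : (Fin n → ℝ) → ℝ} {p : ℝ}

theorem volume_mul_meanOsc_rpow_le_JN [NeZero n] (hl : 0 < l) (hp : 0 < p)
    (hf : IntegrableOn f (axisCube a l)) :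
    volume (axisCube a l) * ENNReal.ofReal (meanOsc f (axisCube a l)) ^ p ≤
      JN p f (axisCube a l) ^ p := by
  have h := tsum_axisCube_le_JN_rpow (κ := Unit) hp hf (a := fun _ => a) (l := fun _ => l)
    (fun _ => hl) (fun _ => Subset.rfl) (fun i j hij => absurd (Subsingleton.elim i j) hij)
  simpa using h

/-- Good-`λ` inequality for functions with finite JN functional. -/
theorem dyadic_goodLambda [NeZero n] (hl : 0 < l) (hp : 0 < p)
    (hf : IntegrableOn f (axisCube a l)) {t : ℝ≥0∞} (ht : t ≠ 0) (ht' : t ≠ ⊤)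
    (hosc : ENNReal.ofReal (meanOsc f (axisCube a l)) ≤ t) {δ : ℝ≥0∞} (hδ : δ ≠ 0)
    (hδ' : δ ≠ ⊤) :
    volume.restrict (halfOpenCube a l)
        (maxSuperlevel (volume.restrict (halfOpenCube a l)) (dyadicIdx a l)
          (fun x => f x - cubeAvg f (axisCube a l)) (2 * 2 ^ n * t)) ≤
      δ * volume.restrict (halfOpenCube a l)
        (maxSuperlevel (volume.restrict (halfOpenCube a l)) (dyadicIdx a l)
          (fun x => f x - cubeAvg f (axisCube a l)) t) +
        JN p f (axisCube a l) ^ p / (δ * t) ^ p := by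
  have hfin : IsFiniteMeasure (volume.restrict (halfOpenCube a l)) := by
    rw [isFiniteMeasure_restrict, measure_congr halfOpenCube_ae_eq]
    exact volume_axisCube_ne_top
  have hd : ∀ k : ℕ, 0 < l / 2 ^ k := fun k => by positivity
  have hv0 : ∀ P : ℕ × (Fin n → ℤ), volume (dyadicCube a l P) ≠ 0 :=
    fun P => volume_axisCube_ne_zero (hd _)
  have hv1 : ∀ P : ℕ × (Fin n → ℤ), volume (dyadicCube a l P) ≠ ⊤ :=
    fun P => volume_axisCube_ne_top
  refine measure_maxSuperlevel_le (measurableSet_preimage_dyadicIdx hl) dyadicIdx_nest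
    (one_le_pow₀ (by norm_num)) (ENNReal.pow_ne_top (by norm_num)) (dyadic_doubling hl) ht ht' ?_
    (c := fun P => cubeAvg f (dyadicCube a l P) - cubeAvg f (axisCube a l))
    (osc := fun P => ENNReal.ofReal (meanOsc f (dyadicCube a l P))) hp.le ?_ ?_ ?_ hδ hδ'
  · intro x
    rw [CellHit, not_lt]
    by_cases h : volume.restrict (halfOpenCube a l) (dyadicIdx a l 0 ⁻¹' {dyadicIdx a l 0 x}) = 0
    · rw [Measure.restrict_eq_zero.2 h]; simp
    have h1 := subset_of_measure_ne_zero hl (P := (0, dyadicIdx a l 0 x)) h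
    have hx : x ∈ halfOpenCube a l := h1 rfl
    rw [← dyadicIdx_zero_preimage hl] at hx
    have hx0 : dyadicIdx a l 0 x = 0 := hx
    rw [hx0] at h1 ⊢
    rw [measure_dyadicCell hl (P := (0, 0)) h1, restrict_dyadicCell hl (P := (0, 0)) h1,
      dyadicCube_zero, ← volume_mul_ofReal_meanOsc (volume_axisCube_ne_zero hl)
        volume_axisCube_ne_top hf, mul_comm]
    gcongr
  · intro P hP
    have h1 := subset_of_measure_ne_zero hl hP
    rw [measure_dyadicCell hl h1, restrict_dyadicCell hl h1, volume_mul_ofReal_meanOsc (hv0 P)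
      (hv1 P) (hf.mono_set (dyadicCube_subset hl h1))]
    simp
  · intro P hP
    have h1 := subset_of_measure_ne_zero hl hP
    rw [measure_dyadicCell hl h1, restrict_dyadicCell hl h1]
    exact enorm_cubeAvg_sub_mul_le (hv0 P) (hv1 P) (hf.mono_set (dyadicCube_subset hl h1)) _
  · intro S hS hdis
    have h1 : ∀ P : S, dyadicIdx a l P.1.1 ⁻¹' {P.1.2} ⊆ halfOpenCube a l :=
      fun P => subset_of_measure_ne_zero hl (hS P P.2)
    simp only [measure_dyadicCell hl (h1 _)]
    refine tsum_axisCube_le_JN_rpow hp hf (a := fun P : S => dyadicCorner a l P.1)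
      (l := fun P : S => l / 2 ^ P.1.1) (fun P => hd _)
      (fun P => dyadicCube_subset hl (h1 P)) fun P R hPR => ?_
    have h2 := hdis P.2 R.2 (Subtype.coe_injective.ne hPR)
    simp only [Function.onFun, preimage_dyadicIdx hl] at h2
    exact (h2.mono interior_axisCube_subset interior_axisCube_subset).inter_eq

end Embedding

section WeakType

variable {n : ℕ} {a : Fin n → ℝ} {l : ℝ} {f : (Fin n → ℝ) → ℝ} {p : ℝ}

/-- Weak-type bound for the dyadic maximal function of `f - f_Q`, for any `K` exceeding the JN
functional. -/
theorem rpow_mul_measure_maxSuperlevel_le [NeZero n] (hl : 0 < l) (hp : 0 < p)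
    (hf : IntegrableOn f (axisCube a l)) {K : ℝ} (hK0 : 0 < K)
    (hK : JN p f (axisCube a l) ≤ ENNReal.ofReal K) {t : ℝ} (ht : 0 < t) :
    t ^ p * (volume.restrict (halfOpenCube a l)
        (maxSuperlevel (volume.restrict (halfOpenCube a l)) (dyadicIdx a l)
          (fun x => f x - cubeAvg f (axisCube a l)) (ENNReal.ofReal t))).toReal ≤
      2 * (2 * 2 ^ n : ℝ) ^ p * (2 * (2 * 2 ^ n : ℝ) ^ p) ^ p * K ^ p := by
  set μ := volume.restrict (halfOpenCube a l) with hμ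
  set g : (Fin n → ℝ) → ℝ := fun x => f x - cubeAvg f (axisCube a l) with hg
  have hv : volume (axisCube a l) ≠ 0 := volume_axisCube_ne_zero hl
  have hv' : volume (axisCube a l) ≠ ⊤ := volume_axisCube_ne_top
  have huniv : μ univ = volume (axisCube a l) := by
    rw [hμ, Measure.restrict_apply_univ, measure_congr halfOpenCube_ae_eq]
  have hfin : IsFiniteMeasure μ := ⟨by rw [huniv]; exact hv'.lt_top⟩
  set V := (volume (axisCube a l)).toReal with hV
  have hVpos : 0 < V := ENNReal.toReal_pos hv hv'
  set τ := K / V ^ (1 / p) with hτ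
  have hτpos : 0 < τ := by positivity
  have hτV : τ ^ p * V = K ^ p := by
    rw [hτ, Real.div_rpow hK0.le (by positivity), ← Real.rpow_mul hVpos.le,
      one_div_mul_cancel hp.ne', Real.rpow_one]
    field_simp
  have hosc : ENNReal.ofReal (meanOsc f (axisCube a l)) ≤ ENNReal.ofReal τ := by
    have h1 := (volume_mul_meanOsc_rpow_le_JN hl hp hf).trans (ENNReal.rpow_le_rpow hK hp.le)
    rw [ENNReal.ofReal_rpow_of_pos hK0, ← hτV, ENNReal.ofReal_mul (by positivity), hV,
      ENNReal.ofReal_toReal hv', mul_comm, ENNReal.mul_le_mul_iff_left hv hv',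
      ← ENNReal.ofReal_rpow_of_pos hτpos] at h1
    exact (ENNReal.rpow_le_rpow_iff hp).1 h1
  have hc1 : (1 : ℝ) < 2 * 2 ^ n := by
    have : (1 : ℝ) ≤ 2 ^ n := one_le_pow₀ (by norm_num)
    linarith
  have hc0 : (0 : ℝ) < 2 * 2 ^ n := by positivity
  refine rpow_mul_le_of_goodLambda
    (m := fun t => (μ (maxSuperlevel μ (dyadicIdx a l) g (ENNReal.ofReal t))).toReal)
    (τ := τ) (V := V) hp hc1 hτpos (fun s => ?_) hVpos.le hτV.le (fun s hs => ?_) ht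
  · exact ENNReal.toReal_mono hv' ((measure_mono (subset_univ _)).trans huniv.le)
  · have hs0 : 0 < s := hτpos.trans_le hs
    have hδ : 0 < (2 * 2 ^ n : ℝ) ^ (-p) / 2 := by positivity
    have h1 := dyadic_goodLambda hl hp hf (t := ENNReal.ofReal s) (by simpa using hs0)
      ENNReal.ofReal_ne_top (hosc.trans (ENNReal.ofReal_le_ofReal hs))
      (δ := ENNReal.ofReal ((2 * 2 ^ n : ℝ) ^ (-p) / 2)) (by simpa using hδ) ENNReal.ofReal_ne_top
    rw [← hμ, ← hg] at h1
    have e : (2 * 2 ^ n * ENNReal.ofReal s : ℝ≥0∞) = ENNReal.ofReal (2 * 2 ^ n * s) := by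
      rw [ENNReal.ofReal_mul hc0.le, ENNReal.ofReal_mul (by norm_num),
        ENNReal.ofReal_pow (by norm_num), ENNReal.ofReal_ofNat]
    have hden : 0 < ((2 * 2 ^ n : ℝ) ^ (-p) / 2 * s) ^ p := by positivity
    rw [e, ← ENNReal.ofReal_mul hδ.le, ENNReal.ofReal_rpow_of_pos (by positivity)] at h1
    have h2 : JN p f (axisCube a l) ^ p ≤ ENNReal.ofReal (K ^ p) := by
      rw [← ENNReal.ofReal_rpow_of_pos hK0]
      exact ENNReal.rpow_le_rpow hK hp.le
    have h3 := h1.trans (add_le_add_right (ENNReal.div_le_div_right h2 _) _)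
    rw [← ENNReal.ofReal_div_of_pos hden] at h3
    have h4 := ENNReal.toReal_mono (ENNReal.add_ne_top.2 ⟨ENNReal.mul_ne_top ENNReal.ofReal_ne_top
      (measure_ne_top _ _), ENNReal.ofReal_ne_top⟩) h3
    rwa [ENNReal.toReal_add (ENNReal.mul_ne_top ENNReal.ofReal_ne_top (measure_ne_top _ _))
      ENNReal.ofReal_ne_top, ENNReal.toReal_mul, ENNReal.toReal_ofReal hδ.le,
      ENNReal.toReal_ofReal (by positivity)] at h4

theorem wkNorm_le_mul_JN [NeZero n] (hl : 0 < l) (hp : 0 < p)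
    (hf : IntegrableOn f (axisCube a l)) (hJN : JN p f (axisCube a l) ≠ ⊤) :
    wkNorm (volume.restrict (axisCube a l)) p (fun x => f x - cubeAvg f (axisCube a l)) ≤
      ENNReal.ofReal ((2 * (2 * 2 ^ n : ℝ) ^ p * (2 * (2 * 2 ^ n : ℝ) ^ p) ^ p) ^ (1 / p)) *
        JN p f (axisCube a l) := by
  set D : ℝ := 2 * (2 * 2 ^ n : ℝ) ^ p * (2 * (2 * 2 ^ n : ℝ) ^ p) ^ p with hD
  have hDpos : 0 < D := by positivity
  refine iSup₂_le fun t ht => ?_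
  rw [distFun, ← Measure.restrict_congr_set halfOpenCube_ae_eq]
  set μ := volume.restrict (halfOpenCube a l) with hμ
  set g : (Fin n → ℝ) → ℝ := fun x => f x - cubeAvg f (axisCube a l) with hg
  have hfin : IsFiniteMeasure μ := by
    rw [isFiniteMeasure_restrict, measure_congr halfOpenCube_ae_eq]
    exact volume_axisCube_ne_top
  have hgi : IntegrableOn g (axisCube a l) := hf.sub (integrableOn_const volume_axisCube_ne_top)
  have hle : μ {x | t < |g x|} ≤ μ (maxSuperlevel μ (dyadicIdx a l) g (ENNReal.ofReal t)) := by
    refine measure_mono_ae ?_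
    filter_upwards [ae_mem_maxSuperlevel hl hgi] with x hx hx'
    exact hx t ht.le hx'
  refine le_trans (mul_le_mul_right (ENNReal.rpow_le_rpow hle (by positivity)) _) ?_
  set M := μ (maxSuperlevel μ (dyadicIdx a l) g (ENNReal.ofReal t)) with hM
  have hMtop : M ≠ ⊤ := measure_ne_top _ _
  have hreal : t * M.toReal ^ (1 / p) ≤ D ^ (1 / p) * (JN p f (axisCube a l)).toReal := by
    rw [← div_le_iff₀' (by positivity)]
    refine le_of_forall_gt_imp_ge_of_dense fun K hK => ?_
    have hK0 : 0 < K := ENNReal.toReal_nonneg.trans_lt hK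
    have h1 := rpow_mul_measure_maxSuperlevel_le hl hp hf hK0
      ((ENNReal.le_ofReal_iff_toReal_le hJN hK0.le).2 hK.le) ht
    have h2 := Real.rpow_le_rpow (by positivity) h1 (show 0 ≤ 1 / p by positivity)
    rw [Real.mul_rpow (by positivity) (by positivity), Real.mul_rpow (by positivity)
      (by positivity), ← Real.rpow_mul ht.le, ← Real.rpow_mul hK0.le,
      mul_one_div_cancel hp.ne', Real.rpow_one, Real.rpow_one] at h2
    rw [div_le_iff₀' (by positivity)]
    exact h2
  have h3 := ENNReal.ofReal_le_ofReal hreal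
  rwa [ENNReal.ofReal_mul ht.le, ENNReal.ofReal_mul (by positivity),
    ← ENNReal.ofReal_rpow_of_nonneg ENNReal.toReal_nonneg (by positivity),
    ENNReal.ofReal_toReal hMtop, ENNReal.ofReal_toReal hJN] at h3

theorem wkNorm_sub_cubeAvg_of_dim_zero (f : (Fin 0 → ℝ) → ℝ) {Q : Set (Fin 0 → ℝ)}
    (hQ : IsCube Q) (hp : 0 < p) :
    wkNorm (volume.restrict Q) p (fun x => f x - cubeAvg f Q) = 0 := by
  obtain ⟨a, l, hl, rfl⟩ := hQ
  have h : ∀ x, f x - cubeAvg f (axisCube a l) = 0 := by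
    intro x
    have e : f = fun _ => f x := funext fun y => congrArg f (Subsingleton.elim y x)
    rw [cubeAvg, e, setAverage_const (volume_axisCube_ne_zero hl) volume_axisCube_ne_top, sub_self]
  rw [wkNorm]
  refine le_antisymm (iSup₂_le fun t ht => ?_) zero_le
  have h2 : {x | t < |f x - cubeAvg f (axisCube a l)|} = ∅ := by
    ext x
    simp [h, ht.le]
  have h3 : 0 < p⁻¹ := inv_pos.2 hp
  change ENNReal.ofReal t * (volume.restrict (axisCube a l)
    {x | t < |f x - cubeAvg f (axisCube a l)|}) ^ (1 / p) ≤ 0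
  rw [h2]
  simp [h3]

end WeakType

/-- John–Nirenberg embedding `JN_p(Q₀) ⊂ L(p,∞)(Q₀)`: there is a constant
`A = A(p,Q₀,n)` such that for every `f ∈ L¹(Q₀)` with `JN_p(f,Q₀) < ∞`,
`sup_{t>0} t (λ_{f-f_{Q₀}}(t))^{1/p} ≤ A · JN_p(f,Q₀)`. -/
theorem jn_embedding {n : ℕ} (p : ℝ) (hp : 1 < p)
    (Q₀ : Set (Fin n → ℝ)) (hQ₀ : IsCube Q₀) :
    ∃ A : ℝ≥0∞, 0 < A ∧ A ≠ ⊤ ∧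
      ∀ f : (Fin n → ℝ) → ℝ, IntegrableOn f Q₀ → JN p f Q₀ ≠ ⊤ →
        wkNorm (volume.restrict Q₀) p (fun x => f x - cubeAvg f Q₀) ≤ A * JN p f Q₀ := by
  have hp0 : 0 < p := by linarith
  rcases Nat.eq_zero_or_pos n with rfl | hn
  · refine ⟨1, one_pos, ENNReal.one_ne_top, fun f _ _ => ?_⟩
    rw [wkNorm_sub_cubeAvg_of_dim_zero f hQ₀ hp0]
    exact zero_le
  · have : NeZero n := ⟨hn.ne'⟩
    obtain ⟨a, l, hl, rfl⟩ := hQ₀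
    exact ⟨_, ENNReal.ofReal_pos.2 (by positivity), ENNReal.ofReal_ne_top,
      fun f hf hJN => wkNorm_le_mul_JN hl hp0 hf hJN⟩
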